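/- arXiv:2402.17428 — 7 statements merged into one kernel-verified Lean document; each statement's English description precedes it below -/
import Mathlib

section
/- For every nonempty string T, either the shortest cover of T equals T itself, or T has a nonempty longest border and the shortest cover of T equals the shortest cover of the longest border of T. (Lemma 2, item 1.) -/
variable {α : Type*}

/-- `v` occurs at (1-indexed) position `i` in `S`. -/
def occursAt (v S : List α) (i : ℕ) : Prop :=
  1 ≤ i ∧ i + v.length ≤ S.length + 1 ∧ (S.drop (i - 1)).take v.length = v

/-- `v` is a cover of `S`: every position of `S` lies within some occurrence of `v`. -/
def isCover (v S : List α) : Prop :=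
  ∀ p : ℕ, 1 ≤ p → p ≤ S.length → ∃ i : ℕ, occursAt v S i ∧ i ≤ p ∧ p < i + v.length

/-- `b` is a border of `S`: a proper prefix and a proper suffix of `S`. -/
def isBorder (b S : List α) : Prop :=
  b.length < S.length ∧ b <+: S ∧ b <:+ S

/-- `p` is a period of `S`: `S[i] = S[i+p]` for all `1 ≤ i ≤ |S| - p` (1-indexed). -/
def isPeriod (p : ℕ) (S : List α) : Prop :=
  1 ≤ p ∧ ∀ i : ℕ, ∀ h : i + p < S.length, S[i]'(by omega) = S[i + p]'h

/-- the smallest period of `S` -/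
noncomputable def per (S : List α) : ℕ := sInf {p | isPeriod p S}

/-- `c` is the shortest cover of `S`. -/
def isShortestCover (c S : List α) : Prop :=
  isCover c S ∧ ∀ c' : List α, isCover c' S → c.length ≤ c'.length

/-- `b` is the longest border of `S`. -/
def isLongestBorder (b S : List α) : Prop :=
  isBorder b S ∧ ∀ b' : List α, isBorder b' S → b'.length ≤ b.length

/-- `r` is the length of the longest common prefix of `X` and `Y`. -/
def isLCPLen (X Y : List α) (r : ℕ) : Prop :=
  r ≤ X.length ∧ r ≤ Y.length ∧ X.take r = Y.take r ∧
  ∀ r' : ℕ, r' ≤ X.length → r' ≤ Y.length → X.take r' = Y.take r' → r' ≤ r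

/-- `l` is the length of the longest prefix of `S` having period `p`. -/
def isLongestPeriodicPrefixLen (p : ℕ) (S : List α) (l : ℕ) : Prop :=
  l ≤ S.length ∧ isPeriod p (S.take l) ∧
  ∀ l' : ℕ, l' ≤ S.length → isPeriod p (S.take l') → l' ≤ l

theorem occursAt_iff_exists_append (v S : List α) (i : ℕ) :
    occursAt v S i ↔ ∃ x y, S = x ++ v ++ y ∧ i = x.length + 1 := by
  constructor
  · rintro ⟨h1, h2, h3⟩
    refine ⟨S.take (i - 1), (S.drop (i - 1)).drop v.length, ?_, ?_⟩
    · conv_lhs => rw [← List.take_append_drop (i - 1) S,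
        ← List.take_append_drop v.length (S.drop (i - 1)), h3]
      simp
    · rw [List.length_take]
      omega
  · rintro ⟨x, y, rfl, rfl⟩
    refine ⟨by omega, by simp; omega, by simp⟩

theorem occursAt_of_isSuffix {v S : List α} (h : v <:+ S) :
    occursAt v S (S.length - v.length + 1) := by
  obtain ⟨x, rfl⟩ := h
  exact (occursAt_iff_exists_append _ _ _).2 ⟨x, [], by simp, by simp⟩

theorem occursAt.trans {u v S : List α} {i j : ℕ} (hu : occursAt u v j) (hv : occursAt v S i) :
    occursAt u S (i + j - 1) := by
  rw [occursAt_iff_exists_append] at *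
  obtain ⟨x, y, rfl, rfl⟩ := hv
  obtain ⟨x', y', rfl, rfl⟩ := hu
  exact ⟨x ++ x', y' ++ y, by simp, by simp; omega⟩

theorem occursAt.of_isPrefix {v b S : List α} {i : ℕ} (h : occursAt v S i) (hb : b <+: S)
    (hi : i + v.length ≤ b.length + 1) : occursAt v b i := by
  obtain ⟨x, y, hS, rfl⟩ := (occursAt_iff_exists_append _ _ _).1 h
  have hx : x ++ v <+: b :=
    List.prefix_of_prefix_length_le ⟨y, hS.symm⟩ hb (by simp; omega)
  obtain ⟨z, rfl⟩ := hx
  exact (occursAt_iff_exists_append _ _ _).2 ⟨x, z, rfl, rfl⟩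

theorem isCover.isPrefix {v S : List α} (h : isCover v S) (hS : S ≠ []) : v <+: S := by
  obtain ⟨i, hi, hle, -⟩ := h 1 le_rfl (List.length_pos_iff.2 hS)
  obtain ⟨x, y, rfl, rfl⟩ := (occursAt_iff_exists_append _ _ _).1 hi
  have hx : x = [] := List.length_eq_zero_iff.1 (by omega)
  subst hx
  exact ⟨y, by simp⟩

theorem isCover.isSuffix {v S : List α} (h : isCover v S) (hS : S ≠ []) : v <:+ S := by
  obtain ⟨i, hi, -, hlt⟩ := h S.length (List.length_pos_iff.2 hS) le_rfl
  obtain ⟨x, y, rfl, rfl⟩ := (occursAt_iff_exists_append _ _ _).1 hi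
  have hy : y = [] := List.length_eq_zero_iff.1 (by simp at hlt; omega)
  subst hy
  exact ⟨x, by simp⟩

theorem isCover.ne_nil {v S : List α} (h : isCover v S) (hS : S ≠ []) : v ≠ [] := by
  rintro rfl
  obtain ⟨i, -, hle, hlt⟩ := h 1 le_rfl (List.length_pos_iff.2 hS)
  simp at hlt
  omega

theorem isCover.trans {u v S : List α} (hu : isCover u v) (hv : isCover v S) : isCover u S := by
  intro p hp hpS
  obtain ⟨i, hi, hip, hpi⟩ := hv p hp hpS
  obtain ⟨j, hj, hjp, hpj⟩ := hu (p - i + 1) (by omega) (by omega)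
  have := hi.1
  have := hj.1
  exact ⟨i + j - 1, hj.trans hi, by omega, by omega⟩

/-- A cover of `S` also covers every string, no shorter than it, that is both a prefix and a
suffix of `S`. -/
theorem isCover.of_isPrefix_of_isSuffix {v b S : List α} (h : isCover v S) (hpre : b <+: S)
    (hsuf : b <:+ S) (hlen : v.length ≤ b.length) : isCover v b := by
  intro p hp hpb
  have hbS := hpre.length_le
  have hS : S ≠ [] := List.length_pos_iff.1 (by omega)
  obtain ⟨i, hi, hip, hpi⟩ := h p hp (by omega)
  by_cases hib : i + v.length ≤ b.length + 1
  · exact ⟨i, hi.of_isPrefix hpre hib, hip, hpi⟩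
  · exact ⟨_, occursAt_of_isSuffix (List.suffix_of_suffix_length_le (h.isSuffix hS) hsuf hlen),
      by omega, by omega⟩

theorem exists_isLongestBorder {S : List α} (hS : S ≠ []) : ∃ b, isLongestBorder b S := by
  classical
  let P : ℕ → Prop := fun n => ∃ b, isBorder b S ∧ b.length = n
  have h0 : P 0 :=
    ⟨[], ⟨List.length_pos_iff.2 hS, List.nil_prefix, List.nil_suffix⟩, rfl⟩
  obtain ⟨b, hb, hlen⟩ : P (Nat.findGreatest P S.length) :=
    Nat.findGreatest_spec (Nat.zero_le _) h0
  refine ⟨b, hb, fun b' hb' => ?_⟩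
  rw [hlen]
  exact Nat.le_findGreatest hb'.1.le ⟨b', hb', rfl⟩

/-- Lemma 2, item 1: for nonempty `T`, either `cov T = T`, or `T` has a nonempty
longest border `b` and `cov T = cov b`. -/
theorem stmt0 (T : List α) (hT : T ≠ []) (c : List α) (hc : isShortestCover c T) :
    c = T ∨ ∃ b : List α, isLongestBorder b T ∧ b ≠ [] ∧ isShortestCover c b := by
  obtain ⟨hcov, hmin⟩ := hc
  have hpre := hcov.isPrefix hT
  have hsuf := hcov.isSuffix hT
  refine or_iff_not_imp_left.2 fun hne => ?_
  have hlt : c.length < T.length :=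
    lt_of_le_of_ne hpre.length_le fun h => hne (hpre.eq_of_length h)
  obtain ⟨b, hb⟩ := exists_isLongestBorder hT
  obtain ⟨-, hbpre, hbsuf⟩ := hb.1
  have hcb : c.length ≤ b.length := hb.2 c ⟨hlt, hpre, hsuf⟩
  have hb0 : b ≠ [] := by
    have := List.length_pos_iff.2 (hcov.ne_nil hT)
    exact List.length_pos_iff.1 (by omega)
  refine ⟨b, hb, hb0, hcov.of_isPrefix_of_isSuffix hbpre hbsuf hcb, fun c' hc' => ?_⟩
  by_contra! hshort
  have hc'c : isCover c' c := hc'.of_isPrefix_of_isSuffix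
    (List.prefix_of_prefix_length_le hpre hbpre hcb)
    (List.suffix_of_suffix_length_le hsuf hbsuf hcb) hshort.le
  exact hshort.not_ge (hmin c' (hc'c.trans hcov))
end

section
/- Let T be a nonempty string and p a positive integer, and let B_p = { |b| : b is a nonempty border of T with per(b) = p }. If B_p is nonempty, then B_p is an arithmetic progression with common difference p; that is, B_p = { a + i·p : 0 ≤ i < t } where a = min B_p and t = |B_p|. (Proposition 1, item 1.) -/
variable {α : Type*}

/-- The prefix of `T` of length `n` has shift `q` as a (possibly zero) period. -/
def PrefixPeriod (T : List α) (q n : ℕ) : Prop :=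
  ∀ i : ℕ, i + q < n → T[i]? = T[i + q]?

theorem isPeriod_take_iff (T : List α) {q n : ℕ} (hn : n ≤ T.length) :
    isPeriod q (T.take n) ↔ 1 ≤ q ∧ PrefixPeriod T q n := by
  refine and_congr_right fun _ => forall_congr' fun i => ?_
  have hl : (T.take n).length = n := by simp [hn]
  refine ⟨fun h hi => ?_, fun h hi => ?_⟩
  · have := h (by omega)
    rw [List.getElem_take, List.getElem_take] at this
    rw [List.getElem?_eq_getElem (by omega), List.getElem?_eq_getElem (by omega), this]
  · have := h (by omega)
    rw [List.getElem?_eq_getElem (by omega), List.getElem?_eq_getElem (by omega)] at this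
    rw [List.getElem_take, List.getElem_take]
    exact Option.some.inj this

theorem per_take_eq_iff (T : List α) {p n : ℕ} (hn0 : 0 < n) (hn : n ≤ T.length) :
    per (T.take n) = p ↔
      1 ≤ p ∧ PrefixPeriod T p n ∧ ∀ q, 1 ≤ q → PrefixPeriod T q n → p ≤ q := by
  have hset : {q | isPeriod q (T.take n)} = {q | 1 ≤ q ∧ PrefixPeriod T q n} :=
    Set.ext fun q => isPeriod_take_iff T hn
  have hne : {q | 1 ≤ q ∧ PrefixPeriod T q n}.Nonempty := ⟨n, hn0, fun i hi => by omega⟩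
  unfold per
  rw [hset]
  constructor
  · rintro rfl
    exact ⟨(Nat.sInf_mem hne).1, (Nat.sInf_mem hne).2, fun q h1 h2 => Nat.sInf_le ⟨h1, h2⟩⟩
  · rintro ⟨h1, h2, h3⟩
    have hmem := Nat.sInf_mem hne
    exact le_antisymm (Nat.sInf_le ⟨h1, h2⟩) (h3 _ hmem.1 hmem.2)

theorem take_suffix_iff (T : List α) {n : ℕ} (hn : n ≤ T.length) :
    T.take n <:+ T ↔ PrefixPeriod T (T.length - n) T.length := by
  have hl : (T.take n).length = n := by simp [hn]
  rw [List.suffix_iff_eq_drop, hl]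
  constructor
  · intro h i hi
    have := congrArg (fun l => l[i]?) h
    simp only [List.getElem?_drop] at this
    rwa [List.getElem?_take_of_lt (by omega), Nat.add_comm] at this
  · intro h
    refine List.ext_getElem? fun i => ?_
    rw [List.getElem?_drop]
    by_cases hi : i < n
    · rw [List.getElem?_take_of_lt hi, h i (by omega), Nat.add_comm]
    · rw [List.getElem?_eq_none (by omega), List.getElem?_eq_none (by omega)]

theorem exists_border_per_iff (T : List α) (p n : ℕ) :
    (∃ b : List α, isBorder b T ∧ b ≠ [] ∧ per b = p ∧ b.length = n) ↔
      0 < n ∧ n < T.length ∧ PrefixPeriod T (T.length - n) T.length ∧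
        1 ≤ p ∧ PrefixPeriod T p n ∧ ∀ q, 1 ≤ q → PrefixPeriod T q n → p ≤ q := by
  constructor
  · rintro ⟨b, ⟨hlt, hpre, hsuf⟩, hb, hper, rfl⟩
    have hpos := List.length_pos_iff.2 hb
    rw [List.prefix_iff_eq_take.1 hpre, per_take_eq_iff T hpos hlt.le] at hper
    rw [List.prefix_iff_eq_take.1 hpre, take_suffix_iff T hlt.le] at hsuf
    exact ⟨hpos, hlt, hsuf, hper⟩
  · rintro ⟨hpos, hlt, hsuf, hper⟩
    have hl : (T.take n).length = n := by simp [hlt.le]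
    exact ⟨T.take n, ⟨by omega, List.take_prefix n T, (take_suffix_iff T hlt.le).2 hsuf⟩,
      List.length_pos_iff.1 (by omega), (per_take_eq_iff T hpos hlt.le).2 hper, hl⟩

namespace PrefixPeriod

variable {T : List α} {p q n : ℕ}

theorem mono {m : ℕ} (h : PrefixPeriod T q n) (hmn : m ≤ n) : PrefixPeriod T q m :=
  fun i hi => h i (by omega)

theorem sub (hp : PrefixPeriod T p n) (hq : PrefixPeriod T q n) (hpq : p ≤ q)
    (hn : p + q ≤ n) : PrefixPeriod T (q - p) n := by
  intro i hi
  by_cases h : i < p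
  · rw [hq i (by omega), hp (i + (q - p)) (by omega)]
    congr 1
    omega
  · have h1 := hp (i - p) (by omega)
    have h2 := hq (i - p) (by omega)
    rw [show i - p + p = i by omega] at h1
    rw [show i - p + q = i + (q - p) by omega] at h2
    rw [← h1, h2]

/-- A weak form of the Fine-Wilf theorem: the smallest period divides every period that is not
too long. -/
theorem dvd_of_minimal (hp0 : 0 < p) (hp : PrefixPeriod T p n)
    (hmin : ∀ r, 1 ≤ r → PrefixPeriod T r n → p ≤ r) (hq : PrefixPeriod T q n)
    (hn : p + q ≤ n) : p ∣ q := by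
  induction q using Nat.strong_induction_on with
  | _ q ih =>
    rcases Nat.eq_zero_or_pos q with rfl | hq0
    · exact dvd_zero p
    have hpq := hmin q hq0 hq
    exact (Nat.dvd_sub_iff_left hpq dvd_rfl).1
      (ih (q - p) (by omega) (hp.sub hq hpq hn) (by omega))

theorem of_borders {m N : ℕ} (hm : PrefixPeriod T (N - m) N) (hn : PrefixPeriod T (N - n) N)
    (hmn : m ≤ n) (hnN : n ≤ N) : PrefixPeriod T (n - m) n := by
  intro i hi
  rw [hm i (by omega), hn (i + (n - m)) (by omega)]
  congr 1
  omega

end PrefixPeriod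

theorem Set.eq_image_add_mul_of_sub_mem {B : Set ℕ} {p : ℕ} (hp : 0 < p) (hfin : B.Finite)
    (hne : B.Nonempty) (hdvd : ∀ m ∈ B, ∀ n ∈ B, m < n → p ∣ n - m)
    (hsub : ∀ m ∈ B, ∀ n ∈ B, m < n → n - p ∈ B) :
    B = (fun i : ℕ => sInf B + i * p) '' {i : ℕ | i < B.ncard} := by
  classical
  have hinj : Function.Injective fun i : ℕ => sInf B + i * p := fun i j h =>
    Nat.eq_of_mul_eq_mul_right hp (Nat.add_left_cancel h)
  have ha := Nat.sInf_mem hne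
  have hdown : ∀ i, sInf B + (i + 1) * p ∈ B → sInf B + i * p ∈ B := by
    intro i hi
    have := hsub _ ha _ hi (Nat.lt_add_of_pos_right (by positivity))
    rwa [show sInf B + (i + 1) * p - p = sInf B + i * p by rw [Nat.succ_mul]; omega] at this
  have hex : ∃ k, sInf B + k * p ∉ B := by
    by_contra! h
    exact Set.infinite_of_injective_forall_mem hinj h hfin
  have hmem : ∀ i, sInf B + i * p ∈ B ↔ i < Nat.find hex := by
    refine fun i => ⟨fun hi => ?_, fun hi => not_not.1 (Nat.find_min hex hi)⟩
    by_contra! hle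
    exact Nat.find_spec hex (Nat.decreasingInduction (motive := fun j _ => sInf B + j * p ∈ B)
      (fun j _ => hdown j) hi hle)
  have hB : B = (fun i : ℕ => sInf B + i * p) '' {i : ℕ | i < Nat.find hex} := by
    ext n
    constructor
    · intro hn
      obtain ⟨i, rfl⟩ : ∃ i, n = sInf B + i * p := by
        rcases (Nat.sInf_le hn).eq_or_lt with h | h
        · exact ⟨0, by omega⟩
        · obtain ⟨c, hc⟩ := hdvd _ ha _ hn h
          exact ⟨c, by rw [Nat.mul_comm c p]; omega⟩
      exact ⟨i, (hmem i).1 hn, rfl⟩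
    · rintro ⟨i, hi, rfl⟩
      exact (hmem i).2 hi
  have hcard : B.ncard = Nat.find hex := by
    have h := congrArg Set.ncard hB
    rw [Set.ncard_image_of_injective _ hinj] at h
    rw [h, show {i : ℕ | i < Nat.find hex} = (Finset.range (Nat.find hex) : Set ℕ) by ext; simp,
      Set.ncard_coe_finset, Finset.card_range]
  rwa [hcard]

/-- Proposition 1, item 1: the set of lengths of nonempty borders of `T` with
smallest period `p` is, if nonempty, an arithmetic progression with common
difference `p`. -/
theorem stmt4 (T : List α) (hT : T ≠ []) (p : ℕ) (hp : 1 ≤ p)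
    (B : Set ℕ)
    (hB : B = {n : ℕ | ∃ b : List α, isBorder b T ∧ b ≠ [] ∧ per b = p ∧ b.length = n})
    (hne : B.Nonempty) :
    B = (fun i : ℕ => sInf B + i * p) '' {i : ℕ | i < B.ncard} := by
  have hmem := fun n => (Set.ext_iff.1 hB n).trans (exists_border_per_iff T p n)
  refine Set.eq_image_add_mul_of_sub_mem hp
    ((Set.finite_Iio T.length).subset fun n hn => ((hmem n).1 hn).2.1) hne ?_ ?_
  · intro m hm n hn hmn
    obtain ⟨hm0, _, hmT, _, _, hmmin⟩ := (hmem m).1 hm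
    obtain ⟨_, hnlt, hnT, _, hnp, hnmin⟩ := (hmem n).1 hn
    have hpm : p ≤ m := hmmin m hm0 fun i hi => by omega
    exact hnp.dvd_of_minimal hp hnmin (hmT.of_borders hnT hmn.le hnlt.le) (by omega)
  · intro m hm n hn hmn
    obtain ⟨hm0, _, hmT, _, _, hmmin⟩ := (hmem m).1 hm
    obtain ⟨_, hnlt, hnT, _, hnp, hnmin⟩ := (hmem n).1 hn
    have hpm : p ≤ m := hmmin m hm0 fun i hi => by omega
    have hle : m ≤ n - p := by
      have := hnmin _ (by omega) (hmT.of_borders hnT hmn.le hnlt.le)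
      omega
    refine (hmem _).2 ⟨by omega, by omega, fun i hi => ?_, hp, hnp.mono (by omega),
      fun q hq h => hmmin q hq (h.mono hle)⟩
    rw [hnp i (by omega), hnT (i + p) (by omega)]
    congr 1
    omega
end

section
/- Let T be a nonempty string and p a positive integer. If at least three distinct borders of T have smallest period equal to p, then every border b of T with per(b) = p, except the shortest such border, is periodic; that is, |b| ≥ 2p. (Proposition 1, item 2.) -/
variable {α : Type*}

theorem per_le_of_isPeriod {p : ℕ} {S : List α} (h : isPeriod p S) : per S ≤ p :=
  Nat.sInf_le h

theorem isPeriod_length {S : List α} (h : S ≠ []) : isPeriod S.length S :=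
  ⟨List.length_pos_iff.mpr h, fun _ hi => by omega⟩

theorem isBorder.isBorder_of_length_lt {b b' S : List α} (hb' : isBorder b' S)
    (hb : isBorder b S) (h : b'.length < b.length) : isBorder b' b :=
  ⟨h, List.prefix_of_prefix_length_le hb'.2.1 hb.2.1 h.le,
    List.suffix_of_suffix_length_le hb'.2.2 hb.2.2 h.le⟩

theorem isBorder.isPeriod_sub {b S : List α} (h : isBorder b S) :
    isPeriod (S.length - b.length) S := by
  obtain ⟨hlt, ⟨u, hu⟩, ⟨v, hv⟩⟩ := h
  refine ⟨by omega, fun i hi => ?_⟩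
  have hib : i < b.length := by omega
  have hpre : S[i] = b[i] := by simp [← hu, hib]
  have hsuf : S[i + (S.length - b.length)] = b[i] := by
    simp only [← hv]
    simp
  rw [hpre, hsuf]

/-- Proposition 1, item 2: if at least three distinct (nonempty) borders of `T`
have smallest period `p`, then every such border except the shortest one is
periodic, i.e., has length at least `2p`. -/
theorem stmt5 (T : List α) (hT : T ≠ []) (p : ℕ) (hp : 1 ≤ p)
    (b₁ b₂ b₃ : List α)
    (h₁ : isBorder b₁ T ∧ b₁ ≠ [] ∧ per b₁ = p)
    (h₂ : isBorder b₂ T ∧ b₂ ≠ [] ∧ per b₂ = p)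
    (h₃ : isBorder b₃ T ∧ b₃ ≠ [] ∧ per b₃ = p)
    (hne : b₁ ≠ b₂ ∧ b₁ ≠ b₃ ∧ b₂ ≠ b₃) :
    ∀ b : List α, isBorder b T → b ≠ [] → per b = p →
      (∃ b' : List α, isBorder b' T ∧ b' ≠ [] ∧ per b' = p ∧ b'.length < b.length) →
      2 * p ≤ b.length := by
  rintro b hb - hper ⟨b', hb', hne', hper', hlt⟩
  have hle : p ≤ b'.length := hper' ▸ per_le_of_isPeriod (isPeriod_length hne')
  have hsub : p ≤ b.length - b'.length :=
    hper ▸ per_le_of_isPeriod (hb'.isBorder_of_length_lt hb hlt).isPeriod_sub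
  omega
end

section
/- Let L and w be strings with 2|w| ≤ |L|, and let b be a border of Lw with |b| > |L|. Set p = |Lw| − |b| and let k be the smallest positive integer with k·p ≥ |w|. Then k ≥ 2, k·p ≤ |L|, and w = L[|L|−kp+1 .. |L|−kp+|w|]; in particular, w occurs as a factor of L. (Long border case, Section 3.2, Figure 3 right.) -/
variable {α : Type*}

/-- A string with border `b` agrees with its shift by `|S| - |b|`. -/
lemma isBorder.getElem?_add {b S : List α} (hb : isBorder b S) {i : ℕ} (hi : i < b.length) :
    S[i + (S.length - b.length)]? = S[i]? := by
  obtain ⟨-, ⟨t, ht⟩, ⟨s, hs⟩⟩ := hb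
  have hlen : S.length - b.length = s.length := by
    rw [← hs, List.length_append]; omega
  have h_left : S[i]? = b[i]? := by
    rw [← ht, List.getElem?_append_left hi]
  have h_right : S[i + s.length]? = b[i]? := by
    rw [← hs, List.getElem?_append_right (by omega), Nat.add_sub_cancel]
  rw [hlen, h_left, h_right]

/-- A string with border `b` agrees with its shifts by multiples of `|S| - |b|`. -/
lemma isBorder.getElem?_add_mul {b S : List α} (hb : isBorder b S) (k i : ℕ)
    (hi : i + k * (S.length - b.length) < S.length) :
    S[i + k * (S.length - b.length)]? = S[i]? := by
  induction k with
  | zero => simp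
  | succ k ih =>
    rw [Nat.succ_mul, ← Nat.add_assoc] at hi ⊢
    rw [hb.getElem?_add (by omega), ih (by omega)]

/-- Section 3.2, Figure 3 (right): if `2|w| ≤ |L|` and `b` is a border of `Lw`
with `|b| > |L|`, then for `p = |Lw| - |b|` and the smallest positive `k` with
`k·p ≥ |w|`, we have `k ≥ 2`, `k·p ≤ |L|`, and
`w = L[|L|-kp+1 .. |L|-kp+|w|]`; in particular `w` is a factor of `L`. -/
theorem stmt9 (L w b : List α) (hLw : 2 * w.length ≤ L.length)
    (hb : isBorder b (L ++ w)) (hlong : L.length < b.length)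
    (p k : ℕ) (hp : p = (L ++ w).length - b.length)
    (hk₁ : 1 ≤ k) (hk₂ : w.length ≤ k * p)
    (hkmin : ∀ k' : ℕ, 1 ≤ k' → w.length ≤ k' * p → k ≤ k') :
    2 ≤ k ∧ k * p ≤ L.length ∧
      w = (L.drop (L.length - k * p)).take w.length ∧ w <:+: L := by
  have hblen := hb.1
  rw [List.length_append] at hblen
  have hpw : p < w.length := by
    rw [hp, List.length_append]; omega
  have hk_two : 2 ≤ k := by
    by_contra h
    obtain rfl : k = 1 := by omega
    omega
  have hlt : (k - 1) * p < w.length := by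
    by_contra h
    have := hkmin (k - 1) (by omega) (by omega)
    omega
  have hkp : k * p ≤ L.length := by
    have : k * p = (k - 1) * p + p := by
      rw [← Nat.succ_mul]; congr 1; omega
    omega
  have hw : w = (L.drop (L.length - k * p)).take w.length := by
    apply List.ext_getElem?
    intro j
    by_cases hj : j < w.length
    · have h := hb.getElem?_add_mul k (L.length - k * p + j)
        (by rw [← hp, List.length_append]; omega)
      rw [← hp, List.getElem?_append_right (by omega), List.getElem?_append_left (by omega)] at h
      rw [List.getElem?_take_of_lt hj, List.getElem?_drop, ← h]
      congr 1
      omega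
    · rw [List.getElem?_eq_none (by omega),
        List.getElem?_eq_none (by rw [List.length_take]; omega)]
  refine ⟨hk_two, hkp, hw, ?_⟩
  rw [hw]
  exact (List.take_prefix _ _).isInfix.trans (List.drop_suffix _ _).isInfix
end

section
/- Let L, w, R be strings, T' = LwR, and suppose the longest border of T' has length greater than |R|, so that it can be written as b*R where b* is a border of Lw. Suppose b* is periodic with smallest period p = per(b*) (so 2p ≤ |b*|). Let l be the length of the longest prefix of T' having period p, and let r = lcp( T'[|Lw|−p+1 .. |T'|], T'[|Lw|+1 .. |T'|] ). Then |b*| ≤ l − r, and every border b of Lw with per(b) = p and |b| ≤ l − r satisfies |b| ≤ |b*|; that is, b* is the longest border of Lw with smallest period p whose length is at most l − r. (Corollary 7.) -/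
variable {α : Type*}

theorem isBorder.getElem?_eq {b S : List α} (h : isBorder b S) {i : ℕ} (hi : i < b.length) :
    S[i]? = S[S.length - b.length + i]? := by
  obtain ⟨-, ⟨u, rfl⟩, ⟨v, hv⟩⟩ := h
  have hlen := congrArg List.length hv
  simp only [List.length_append] at hlen
  have h1 : (b ++ u)[i]? = b[i]? := List.getElem?_append_left hi
  rw [h1, ← hv, List.length_append, Nat.add_sub_cancel, List.getElem?_append_right (by omega),
    Nat.add_sub_cancel_left]

theorem isBorder_take {S : List α} {k : ℕ} (hk : k < S.length)
    (h : ∀ i < k, S[i]? = S[S.length - k + i]?) : isBorder (S.take k) S := by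
  refine ⟨by simp; omega, List.take_prefix _ _, ?_⟩
  have heq : S.take k = S.drop (S.length - k) := by
    apply List.ext_getElem?
    intro i
    rw [List.getElem?_drop, List.getElem?_take]
    split_ifs with hi
    · exact h i hi
    · rw [List.getElem?_eq_none (by omega)]
  rw [heq]
  exact List.drop_suffix _ _

theorem isPeriod_iff_getElem? {p : ℕ} {S : List α} :
    isPeriod p S ↔ 1 ≤ p ∧ ∀ i, i + p < S.length → S[i]? = S[i + p]? := by
  unfold isPeriod
  refine and_congr_right fun _ => forall_congr' fun i => forall_congr' fun h => ?_
  rw [List.getElem?_eq_getElem h, List.getElem?_eq_getElem (by omega), Option.some_inj]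

theorem isPeriod_take_iff_s12 {p l : ℕ} {S : List α} (hl : l ≤ S.length) :
    isPeriod p (S.take l) ↔ 1 ≤ p ∧ ∀ i, i + p < l → S[i]? = S[i + p]? := by
  rw [isPeriod_iff_getElem?, List.length_take, min_eq_left hl]
  refine and_congr_right fun _ => forall_congr' fun i => forall_congr' fun h => ?_
  rw [List.getElem?_take_of_lt h, List.getElem?_take_of_lt (by omega)]

theorem isPeriod_per (S : List α) : isPeriod (per S) S :=
  Nat.sInf_mem (s := {p | isPeriod p S})
    ⟨S.length + 1, by omega, fun i h => absurd h (by omega)⟩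

theorem isLCPLen.getElem?_eq {X Y : List α} {r i : ℕ} (h : isLCPLen X Y r) (hi : i < r) :
    X[i]? = Y[i]? := by
  have := congrArg (fun Z : List α => Z[i]?) h.2.2.1
  simpa only [List.getElem?_take_of_lt hi] using this

theorem isLCPLen.getElem?_ne {X Y : List α} {r : ℕ} (h : isLCPLen X Y r)
    (hX : r < X.length) (hY : r < Y.length) : X[r]? ≠ Y[r]? := by
  intro heq
  have := h.2.2.2 (r + 1) hX hY (by rw [List.take_add_one, List.take_add_one, h.2.2.1, heq])
  omega

/-- Corollary 7: if the longest border of `T' = LwR` is `b*R` with `b*` a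
periodic border of `Lw` of smallest period `p`, then `b*` is the longest border
of `Lw` with smallest period `p` whose length is at most `l - r`. -/
theorem stmt12 (L w R bstar : List α)
    (hbstar : isBorder bstar (L ++ w))
    (hlb : isLongestBorder (bstar ++ R) (L ++ w ++ R))
    (p : ℕ) (hp : per bstar = p) (hperiodic : 2 * p ≤ bstar.length)
    (l : ℕ) (hl : isLongestPeriodicPrefixLen p (L ++ w ++ R) l)
    (r : ℕ)
    (hr : isLCPLen ((L ++ w ++ R).drop ((L ++ w).length - p))
      ((L ++ w ++ R).drop (L ++ w).length) r) :
    bstar.length + r ≤ l ∧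
      ∀ b : List α, isBorder b (L ++ w) → per b = p → b.length + r ≤ l →
        b.length ≤ bstar.length := by
  have hpre : bstar <+: L ++ w ++ R := hbstar.2.1.trans (List.prefix_append _ _)
  have hkn := hbstar.1
  have hper := isPeriod_iff_getElem?.1 (hp ▸ isPeriod_per bstar)
  have hleft : ∀ i < (L ++ w).length, (L ++ w)[i]? = (L ++ w ++ R)[i]? := fun i hi =>
    (List.getElem?_append_left hi).symm
  have hlen : (L ++ w ++ R).length = (L ++ w).length + R.length := List.length_append
  generalize L ++ w ++ R = T at *
  generalize L ++ w = S at *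
  obtain ⟨hlT, hlper, hlmax⟩ := hl
  have hlper' := ((isPeriod_take_iff_s12 hlT).1 hlper).2
  have hrR := hr.2.1
  rw [List.length_drop] at hrR
  have hshift : ∀ i < bstar.length + R.length, T[i]? = T[S.length - bstar.length + i]? := by
    intro i hi
    rw [hlb.1.getElem?_eq (by simpa using hi), List.length_append]
    congr 1
    omega
  have hlcp : ∀ i < r, T[S.length - p + i]? = T[S.length + i]? := by
    intro i hi
    simpa only [List.getElem?_drop] using hr.getElem?_eq hi
  -- Positions around the end of `S` in `T` correspond to positions around the end of `bstar`.
  have hback : ∀ i < R.length, T[bstar.length - p + i]? = T[S.length - p + i]? := by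
    intro i hi
    rw [hshift _ (by omega)]
    congr 1
    omega
  have hfront : ∀ i < R.length, T[bstar.length + i]? = T[S.length + i]? := by
    intro i hi
    rw [hshift _ (by omega)]
    congr 1
    omega
  refine ⟨hlmax _ (by omega) ((isPeriod_take_iff_s12 (by omega)).2 ⟨hper.1, fun i hi => ?_⟩), ?_⟩
  · by_cases hik : i + p < bstar.length
    · obtain ⟨u, rfl⟩ := hpre
      rw [List.getElem?_append_left (by omega), List.getElem?_append_left hik]
      exact hper.2 i hik
    · obtain ⟨j, hj⟩ : ∃ j, i + p = bstar.length + j := ⟨i + p - bstar.length, by omega⟩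
      have hi' : i = bstar.length - p + j := by omega
      rw [hj, hi', hback j (by omega), hfront j (by omega), hlcp j (by omega)]
  · intro b hb _ hbl
    by_contra! hlt
    have hbn := hb.1
    have hrm : r = R.length := by
      by_contra hne
      apply hr.getElem?_ne (by rw [List.length_drop]; omega) (by rw [List.length_drop]; omega)
      rw [List.getElem?_drop, List.getElem?_drop, ← hback r (by omega), ← hfront r (by omega),
        hlper' _ (by omega)]
      congr 1
      omega
    have hext : ∀ i < b.length + R.length, T[i]? = T[S.length - b.length + i]? := by
      intro i
      induction i using Nat.strong_induction_on with
      | _ i ih =>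
        intro hi
        by_cases hib : i < b.length
        · rw [← hleft i (by omega), ← hleft _ (by omega)]
          exact hb.getElem?_eq hib
        · have h1 := hlper' (i - p) (by omega)
          have h2 := hlcp (i - b.length) (by omega)
          have h3 := ih (i - p) (by omega) (by omega)
          rw [show i - p + p = i by omega] at h1
          rw [← h1, h3, show S.length - b.length + (i - p) = S.length - p + (i - b.length) by omega,
            h2]
          congr 1
          omega
    have hbig := hlb.2 _ (isBorder_take (k := b.length + R.length) (by omega) fun i hi => by
      rw [hext i hi]
      congr 1
      omega)
    rw [List.length_take, List.length_append] at hbig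
    omega
end

section
/- Let T be a string and let k, L' be integers with 1 ≤ k ≤ L' ≤ |T|. If the prefix T[1..k] is a cover of T[1..m] for some m with L' < m ≤ |T|, then T[1..k] occurs in T at some position s with max(1, L'−2k+2) ≤ s ≤ L'−k+1; in particular, this occurrence is contained in T[1..L'] and covers position L'−k+1. (Claim 9 in the proof of Lemma 8.) -/
variable {α : Type*}

theorem occursAt_take_iff {v T : List α} {n i : ℕ} (hn : n ≤ T.length) :
    occursAt v (T.take n) i ↔ occursAt v T i ∧ i + v.length ≤ n + 1 := by
  have key (h₁ : 1 ≤ i) (h₂ : i + v.length ≤ n + 1) :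
      ((T.take n).drop (i - 1)).take v.length = (T.drop (i - 1)).take v.length := by
    rw [List.drop_take, List.take_take, Nat.min_eq_left (by omega)]
  simp only [occursAt, List.length_take_of_le hn]
  constructor
  · rintro ⟨h₁, h₂, h₃⟩
    exact ⟨⟨h₁, by omega, key h₁ h₂ ▸ h₃⟩, h₂⟩
  · rintro ⟨⟨h₁, -, h₃⟩, h₂⟩
    exact ⟨h₁, h₂, (key h₁ h₂).trans h₃⟩

/-- Claim 9: if the prefix `T[1..k]` covers `T[1..m]` for some `m > L'`, then
`T[1..k]` occurs in `T` at some position `s` with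
`max(1, L'-2k+2) ≤ s ≤ L'-k+1`; in particular this occurrence lies within
`T[1..L']` (and covers position `L'-k+1`). -/
theorem stmt13 (T : List α) (k L' : ℕ) (hk : 1 ≤ k) (hkL : k ≤ L')
    (hL : L' ≤ T.length)
    (m : ℕ) (hm₁ : L' < m) (hm₂ : m ≤ T.length)
    (hcov : isCover (T.take k) (T.take m)) :
    ∃ s : ℕ, occursAt (T.take k) T s ∧
      L' + 2 ≤ s + 2 * k ∧ s + k ≤ L' + 1 ∧
      occursAt (T.take k) (T.take L') s := by
  have hlen : (T.take k).length = k := List.length_take_of_le (hkL.trans hL)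
  obtain ⟨s, hs, hsp, hps⟩ := hcov (L' - k + 1) (by omega)
    (by rw [List.length_take_of_le hm₂]; omega)
  have hT := ((occursAt_take_iff hm₂).1 hs).1
  rw [hlen] at hps
  exact ⟨s, hT, by omega, by omega, (occursAt_take_iff hL).2 ⟨hT, by omega⟩⟩
end

section
/- Let u and v be strings with uv nonempty, and let S = uvuvu. If the smallest period of S equals |uv|, then every border of uvu has length at most |uv|. (Lemma 10.) -/
variable {α : Type*}

/-- If `t ++ b` has `b` as a prefix and `t` is nonempty, then `t.length` is a period. -/
theorem isPeriod_length_of_prefix {t b : List α} (ht : 1 ≤ t.length) (hb : b <+: t ++ b) :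
    isPeriod t.length (t ++ b) := by
  refine ⟨ht, fun i h => ?_⟩
  have hi : i < b.length := by
    rw [List.length_append] at h
    omega
  rw [← hb.getElem hi, List.getElem_append_right (by omega)]
  simp

/-- If `S` has period `n` and its prefix `W` of length at least `n + q` has period `q`,
then `S` has period `q`. -/
theorem isPeriod_of_prefix {n q : ℕ} {W S : List α} (hS : isPeriod n S) (hW : isPeriod q W)
    (hpre : W <+: S) (hlen : n + q ≤ W.length) : isPeriod q S := by
  refine ⟨hW.1, fun i => ?_⟩
  induction i using Nat.strong_induction_on with
  | _ i ih =>
    intro h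
    by_cases hi : i < n
    · have hiq : i + q < W.length := by omega
      rw [← hpre.getElem hiq, ← hpre.getElem (show i < W.length by omega)]
      exact hW.2 i hiq
    · obtain ⟨j, rfl⟩ : ∃ j, i = j + n := ⟨i - n, by omega⟩
      have hn := hS.1
      have h₁ := hS.2 j (by omega)
      have h₂ := hS.2 (j + q) (by omega)
      have h₃ := ih j (by omega) (by omega)
      rw [← h₁, h₃, h₂]
      congr 1
      omega

/-- Lemma 10: if the smallest period of `S = uvuvu` equals `|uv|`, then every
border of `uvu` has length at most `|uv|`. -/
theorem stmt14 (u v : List α) (huv : u ++ v ≠ [])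
    (hper : per (u ++ v ++ u ++ v ++ u) = (u ++ v).length) :
    ∀ b : List α, isBorder b (u ++ v ++ u) → b.length ≤ (u ++ v).length := by
  rintro b ⟨hlt, hpre, t, ht⟩
  by_contra! hb
  have hlen := congrArg List.length ht
  rw [List.length_append, List.length_append (as := u ++ v)] at hlen
  have hW : isPeriod t.length (u ++ v ++ u) := by
    rw [← ht] at hpre hlt ⊢
    rw [List.length_append] at hlt
    exact isPeriod_length_of_prefix (by omega) hpre
  have hWS : u ++ v ++ u <+: u ++ v ++ u ++ v ++ u := ⟨v ++ u, by simp⟩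
  have hS : isPeriod (u ++ v).length (u ++ v ++ u ++ v ++ u) := by
    have e : u ++ v ++ u ++ v ++ u = (u ++ v) ++ (u ++ v ++ u) := by simp
    rw [e] at hWS ⊢
    exact isPeriod_length_of_prefix (List.length_pos_iff.2 huv) hWS
  have hle : per (u ++ v ++ u ++ v ++ u) ≤ t.length :=
    Nat.sInf_le (isPeriod_of_prefix hS hW hWS (by rw [List.length_append (as := u ++ v)]; omega))
  rw [hper, List.length_append] at hle
  omega
end
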